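/- Let 0 < ℓ < 1, 0 < u ≤ 1, ε ∈ (0, 1], and let the integer m satisfy m ≥ √( u / (2·ε·ℓ·ln(1/(1−ℓ))) ). Then for every p with ℓ ≤ p ≤ 1 − ℓ and p ≤ u, −f_m(p) ≥ p·ln(1/p) − ε·ℓ·ln(1/(1−ℓ)) ≥ (1 − ε)·ℓ·ln(1/(1−ℓ)) ≥ 0. Consequently, if R is a density matrix whose eigenvalues all lie in [ℓ, min(u, 1−ℓ)], the matrix −f_m(R) is symmetric positive semidefinite. -/

import Mathlib

open Polynomial Matrix

/-- The Chebyshev coefficients `α_w`: `α_0 = (u/2)(ln(u/4)+1)`,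
`α_1 = (u/4)(2 ln(u/4)+3)`, `α_w = (−1)^w u/(w³−w)` for `w ≥ 2`. -/
noncomputable def chebCoef (u : ℝ) : ℕ → ℝ
  | 0 => u / 2 * (Real.log (u / 4) + 1)
  | 1 => u / 4 * (2 * Real.log (u / 4) + 3)
  | (w + 2) => (-1 : ℝ) ^ (w + 2) * u / (((w + 2 : ℕ) : ℝ) ^ 3 - ((w + 2 : ℕ) : ℝ))

/-- The degree-`m` Chebyshev approximant `f_m(x) = ∑_{w=0}^m α_w T_w((2/u)x − 1)`. -/
noncomputable def chebApprox (u : ℝ) (m : ℕ) (x : ℝ) : ℝ :=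
  ∑ w ∈ Finset.range (m + 1),
    chebCoef u w * (Polynomial.Chebyshev.T ℝ (w : ℤ)).eval (2 / u * x - 1)

open Filter Topology in
theorem aux_tele (k : ℕ) :
    HasSum (fun n : ℕ => 1 / (((n + k + 2 : ℕ) : ℝ) ^ 3 - ((n + k + 2 : ℕ) : ℝ)))
      (1 / (2 * ((k : ℝ) + 1) * (k + 2))) := by
  have hpos : ∀ n : ℕ, (0 : ℝ) < ((n + k + 2 : ℕ) : ℝ) ^ 3 - ((n + k + 2 : ℕ) : ℝ) := by
    intro n
    have : ((n + k + 2 : ℕ) : ℝ) ^ 3 - ((n + k + 2 : ℕ) : ℝ)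
        = ((n : ℝ) + k + 1) * (n + k + 2) * (n + k + 3) := by push_cast; ring
    rw [this]; positivity
  rw [hasSum_iff_tendsto_nat_of_nonneg (fun n => (one_div_pos.2 (hpos n)).le)]
  have hs : ∀ N : ℕ, ∑ n ∈ Finset.range N,
      1 / (((n + k + 2 : ℕ) : ℝ) ^ 3 - ((n + k + 2 : ℕ) : ℝ))
      = 1 / (2 * ((k : ℝ) + 1) * (k + 2))
        - 1 / (2 * ((N : ℝ) + k + 2)) * (1 / ((N : ℝ) + (k + 1))) := by
    intro N
    induction N with
    | zero => simp; field_simp; ring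
    | succ N ih =>
      rw [Finset.sum_range_succ, ih]
      have : ((N + k + 2 : ℕ) : ℝ) ^ 3 - ((N + k + 2 : ℕ) : ℝ)
        = ((N : ℝ) + k + 1) * (N + k + 2) * (N + k + 3) := by push_cast; ring
      rw [this]
      push_cast
      have h1 : (N : ℝ) + 1 + k + 2 = N + k + 3 := by ring
      have h2 : (N : ℝ) + 1 + (k + 1) = N + k + 2 := by ring
      have h3 : (N : ℝ) + (k + 1) = N + k + 1 := by ring
      rw [h1, h2, h3]
      field_simp
      ring
  simp_rw [hs]
  have ht : ∀ c : ℝ, Tendsto (fun N : ℕ => 1 / ((N : ℝ) + c)) atTop (𝓝 0) := by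
    intro c
    simp_rw [one_div]
    exact tendsto_inv_atTop_zero.comp
      (tendsto_atTop_add_const_right _ _ tendsto_natCast_atTop_atTop)
  have h := ((ht (k + 2)).const_mul (1 / 2)).mul (ht (k + 1))
  have h' := (tendsto_const_nhds (x := 1 / (2 * ((k : ℝ) + 1) * (k + 2)))).sub h
  simp only [mul_zero, sub_zero] at h'
  refine h'.congr (fun N => ?_)
  have h3 : (N : ℝ) + (k + 2) = N + k + 2 := by ring
  rw [h3]
  congr 2
  field_simp

theorem aux_disc (z : ℂ) (hz : ‖z‖ < 1) :
    HasSum (fun n : ℕ => z * ((-1) ^ n * z ^ (n + 2) /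
        (((n + 2 : ℕ) : ℂ) ^ 3 - ((n + 2 : ℕ) : ℂ))))
      ((1 + z) ^ 2 * Complex.log (1 + z) / 2 - z / 2 - 3 / 4 * z ^ 2) := by
  have h := Complex.hasSum_taylorSeries_log hz
  have h1 := ((hasSum_nat_add_iff' 1).2 h).mul_left (z ^ 2 / 2)
  have h2 := ((hasSum_nat_add_iff' 2).2 h).mul_left z
  have h3 := ((hasSum_nat_add_iff' 3).2 h).mul_left (1 / 2)
  have h4 := (h1.add h2).add h3
  have key : ∀ (f g : ℕ → ℂ) (a b : ℂ), HasSum f a → (∀ n, g n = f n) → b = a → HasSum g b := by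
    intro f g a b hf hfg hab
    rw [hab, show g = f from _root_.funext hfg]
    exact hf
  refine key _ _ _ _ h4 ?_ ?_
  · intro n
    have e1 : (n : ℂ) + 1 ≠ 0 := by exact_mod_cast Nat.succ_ne_zero n
    have e2 : (n : ℂ) + 2 ≠ 0 := by exact_mod_cast Nat.succ_ne_zero (n + 1)
    have e3 : (n : ℂ) + 3 ≠ 0 := by exact_mod_cast Nat.succ_ne_zero (n + 2)
    have e : (((n + 2 : ℕ) : ℂ) ^ 3 - ((n + 2 : ℕ) : ℂ)) = (n + 1) * (n + 2) * (n + 3) := by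
      push_cast; ring
    rw [e]
    push_cast
    field_simp
    ring
  · simp [Finset.sum_range_succ]
    ring

open Filter Topology in
theorem aux_circle (z : ℂ) (hz : ‖z‖ = 1) (hz1 : 1 + z ∈ Complex.slitPlane) :
    z * ∑' n : ℕ, ((-1) ^ n * z ^ (n + 2) /
        (((n + 2 : ℕ) : ℂ) ^ 3 - ((n + 2 : ℕ) : ℂ))) =
      ((1 + z) ^ 2 * Complex.log (1 + z) / 2 - z / 2 - 3 / 4 * z ^ 2) := by
  have ht : Tendsto (fun r : ℝ => (r : ℂ) * z) (𝓝[<] 1) (𝓝 z) := by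
    have : Tendsto (fun r : ℝ => (r : ℂ) * z) (𝓝 1) (𝓝 (((1 : ℝ) : ℂ) * z)) :=
      Continuous.tendsto (by fun_prop) 1
    simp only [Complex.ofReal_one, one_mul] at this
    exact this.mono_left nhdsWithin_le_nhds
  have hev : ∀ᶠ r : ℝ in 𝓝[<] 1, ‖(r : ℂ) * z‖ < 1 := by
    filter_upwards [Ioo_mem_nhdsLT (show (0 : ℝ) < 1 by norm_num)] with r hr
    rw [norm_mul, hz, mul_one, Complex.norm_real, Real.norm_eq_abs, abs_of_pos hr.1]
    exact hr.2
  have hl : Tendsto (fun r : ℝ => ((r : ℂ) * z) * ∑' n : ℕ, ((-1) ^ n * ((r : ℂ) * z) ^ (n + 2) /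
        (((n + 2 : ℕ) : ℂ) ^ 3 - ((n + 2 : ℕ) : ℂ)))) (𝓝[<] 1)
      (𝓝 (z * ∑' n : ℕ, ((-1) ^ n * z ^ (n + 2) /
        (((n + 2 : ℕ) : ℂ) ^ 3 - ((n + 2 : ℕ) : ℂ))))) := by
    refine ht.mul ?_
    refine tendsto_tsum_of_dominated_convergence (aux_tele 0).summable ?_ ?_
    · intro n
      exact ((ht.pow (n + 2)).const_mul _).div_const _
    · filter_upwards [hev] with r hr n
      have e : (((n + 2 : ℕ) : ℂ) ^ 3 - ((n + 2 : ℕ) : ℂ)) =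
          (((((n + 0 + 2 : ℕ) : ℝ) ^ 3 - ((n + 0 + 2 : ℕ) : ℝ) : ℝ)) : ℂ) := by
        push_cast; ring
      have hpos : (0 : ℝ) ≤ ((n + 0 + 2 : ℕ) : ℝ) ^ 3 - ((n + 0 + 2 : ℕ) : ℝ) := by
        have : ((n + 0 + 2 : ℕ) : ℝ) ^ 3 - ((n + 0 + 2 : ℕ) : ℝ)
          = ((n : ℝ) + 1) * (n + 2) * (n + 3) := by push_cast; ring
        rw [this]; positivity
      rw [e, norm_div, Complex.norm_real, Real.norm_eq_abs, abs_of_nonneg hpos]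
      refine div_le_div_of_nonneg_right ?_ hpos
      rw [norm_mul, norm_pow, norm_pow, norm_neg, norm_one, one_pow, one_mul]
      exact pow_le_one₀ (norm_nonneg _) hr.le
  have hlog : Tendsto (fun r : ℝ => Complex.log (1 + (r : ℂ) * z)) (𝓝[<] 1)
      (𝓝 (Complex.log (1 + z))) :=
    (continuousAt_clog hz1).tendsto.comp (ht.const_add 1)
  have hr := ((((ht.const_add 1).pow 2).mul hlog).div_const 2).sub (ht.div_const 2)
  have hr' := hr.sub ((ht.pow 2).const_mul (3 / 4))
  refine tendsto_nhds_unique hl (hr'.congr' ?_)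
  filter_upwards [hev] with r hr
  rw [← tsum_mul_left, (aux_disc _ hr).tsum_eq]

theorem aux_cos (θ : ℝ) (hθ : -1 < Real.cos θ) :
    HasSum (fun n : ℕ => (-1) ^ n * Real.cos ((n + 2 : ℕ) * θ) /
        (((n + 2 : ℕ) : ℝ) ^ 3 - ((n + 2 : ℕ) : ℝ)))
      ((1 + Real.cos θ) * Real.log (2 + 2 * Real.cos θ) / 2 - 1 / 2 - 3 / 4 * Real.cos θ) := by
  set z : ℂ := Complex.exp (θ * Complex.I) with hzdef
  have hre : z.re = Real.cos θ := Complex.exp_ofReal_mul_I_re θ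
  have him : z.im = Real.sin θ := Complex.exp_ofReal_mul_I_im θ
  have hz : ‖z‖ = 1 := Complex.norm_exp_ofReal_mul_I θ
  have hz0 : z ≠ 0 := Complex.exp_ne_zero _
  have hz1 : 1 + z ∈ Complex.slitPlane := by
    left; simp [hre]; linarith
  have hpow : ∀ n : ℕ, (z ^ n).re = Real.cos (n * θ) := by
    intro n
    rw [hzdef, ← Complex.exp_nat_mul, ← Complex.exp_ofReal_mul_I_re]
    congr 2; push_cast; ring
  have hc := aux_circle z hz hz1
  have hterm : ∀ n : ℕ, ((-1) ^ n * z ^ (n + 2) /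
        (((n + 2 : ℕ) : ℂ) ^ 3 - ((n + 2 : ℕ) : ℂ))).re =
        (-1) ^ n * Real.cos ((n + 2 : ℕ) * θ) /
        (((n + 2 : ℕ) : ℝ) ^ 3 - ((n + 2 : ℕ) : ℝ)) := by
    intro n
    have e : (-1) ^ n * z ^ (n + 2) /
        (((n + 2 : ℕ) : ℂ) ^ 3 - ((n + 2 : ℕ) : ℂ)) =
        (((-1) ^ n / (((n + 2 : ℕ) : ℝ) ^ 3 - ((n + 2 : ℕ) : ℝ)) : ℝ) : ℂ) * z ^ (n + 2) := by
      push_cast; ring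
    rw [e, Complex.re_ofReal_mul, hpow]
    ring
  have hsum : Summable (fun n : ℕ => (-1) ^ n * z ^ (n + 2) /
        (((n + 2 : ℕ) : ℂ) ^ 3 - ((n + 2 : ℕ) : ℂ))) := by
    refine Summable.of_norm_bounded (aux_tele 0).summable ?_
    intro n
    have e : (((n + 2 : ℕ) : ℂ) ^ 3 - ((n + 2 : ℕ) : ℂ)) =
        (((((n + 0 + 2 : ℕ) : ℝ) ^ 3 - ((n + 0 + 2 : ℕ) : ℝ) : ℝ)) : ℂ) := by
      push_cast; ring
    have hpos : (0 : ℝ) ≤ ((n + 0 + 2 : ℕ) : ℝ) ^ 3 - ((n + 0 + 2 : ℕ) : ℝ) := by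
      have : ((n + 0 + 2 : ℕ) : ℝ) ^ 3 - ((n + 0 + 2 : ℕ) : ℝ)
        = ((n : ℝ) + 1) * (n + 2) * (n + 3) := by push_cast; ring
      rw [this]; positivity
    rw [e, norm_div, Complex.norm_real, Real.norm_eq_abs, abs_of_nonneg hpos]
    refine div_le_div_of_nonneg_right ?_ hpos
    rw [norm_mul, norm_pow, norm_pow, norm_neg, norm_one, one_pow, one_mul, hz, one_pow]
  have hH := Complex.hasSum_re hsum.hasSum
  simp_rw [hterm] at hH
  convert hH using 1
  set S := ∑' n : ℕ, ((-1) ^ n * z ^ (n + 2) /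
        (((n + 2 : ℕ) : ℂ) ^ 3 - ((n + 2 : ℕ) : ℂ)))
  have hzz : z⁻¹ = (starRingEnd ℂ) z := by
    rw [Complex.inv_def, Complex.normSq_eq_norm_sq, hz]; simp
  have hconj : z + z⁻¹ = ((2 * Real.cos θ : ℝ) : ℂ) := by
    rw [hzz, Complex.add_conj, hre]
  have hS : S = ((1 + Real.cos θ : ℝ) : ℂ) * Complex.log (1 + z)
      - ((1 / 2 : ℝ) : ℂ) - ((3 / 4 : ℝ) : ℂ) * z := by
    have e : ((1 + Real.cos θ : ℝ) : ℂ) = (1 + z) ^ 2 / (2 * z) := by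
      have : ((1 + Real.cos θ : ℝ) : ℂ) = 1 + ((2 * Real.cos θ : ℝ) : ℂ) / 2 := by
        push_cast; ring
      rw [this, ← hconj]
      field_simp
      ring
    rw [e]
    apply mul_left_cancel₀ hz0
    rw [hc]
    push_cast
    field_simp
  rw [hS, Complex.sub_re, Complex.sub_re, Complex.re_ofReal_mul, Complex.re_ofReal_mul,
    Complex.ofReal_re, hre, Complex.log_re]
  have hn : ‖1 + z‖ ^ 2 = 2 + 2 * Real.cos θ := by
    rw [← Complex.normSq_eq_norm_sq, Complex.normSq_apply]
    simp only [Complex.add_re, Complex.add_im, Complex.one_re, Complex.one_im, hre, him]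
    nlinarith [Real.sin_sq_add_cos_sq θ]
  rw [← hn, Real.log_pow]
  push_cast
  ring

theorem aux_main (u : ℝ) (hu : 0 < u) (k : ℕ) (p : ℝ) (hp : 0 < p) (hpu : p ≤ u) :
    chebApprox u (k + 1) p ≤ p * Real.log p + u * (1 / (2 * ((k : ℝ) + 1) * (k + 2))) := by
  set θ := Real.arccos (2 / u * p - 1) with hθ
  have hx : 0 < 2 / u * p := by positivity
  have hx2 : 2 / u * p ≤ 2 := by
    rw [div_mul_eq_mul_div, div_le_iff₀ hu]; linarith
  have hcos : Real.cos θ = 2 / u * p - 1 := Real.cos_arccos (by linarith) (by linarith)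
  have hs := (aux_cos θ (by linarith)).mul_left u
  have hsplit := hs.summable.sum_add_tsum_nat_add k
  rw [hs.tsum_eq] at hsplit
  have htail := tsum_of_norm_bounded (f := fun n : ℕ => u * ((-1) ^ (n + k) *
      Real.cos ((n + k + 2 : ℕ) * θ) /
        (((n + k + 2 : ℕ) : ℝ) ^ 3 - ((n + k + 2 : ℕ) : ℝ)))) ((aux_tele k).mul_left u) (by
    intro n
    have hpos : (0 : ℝ) ≤ ((n + k + 2 : ℕ) : ℝ) ^ 3 - ((n + k + 2 : ℕ) : ℝ) := by
      have : ((n + k + 2 : ℕ) : ℝ) ^ 3 - ((n + k + 2 : ℕ) : ℝ)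
        = ((n : ℝ) + k + 1) * (n + k + 2) * (n + k + 3) := by push_cast; ring
      rw [this]; positivity
    rw [norm_mul, Real.norm_of_nonneg hu.le, norm_div, Real.norm_of_nonneg hpos]
    refine mul_le_mul_of_nonneg_left (div_le_div_of_nonneg_right ?_ hpos) hu.le
    rw [norm_mul, norm_pow, norm_neg, norm_one, one_pow, one_mul]
    exact Real.abs_cos_le_one _)
  have htail' := (abs_le.1 htail).1
  have hcheb : chebApprox u (k + 1) p = chebCoef u 0 + chebCoef u 1 * Real.cos θ +
      ∑ n ∈ Finset.range k, u * ((-1) ^ n * Real.cos ((n + 2 : ℕ) * θ) /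
        (((n + 2 : ℕ) : ℝ) ^ 3 - ((n + 2 : ℕ) : ℝ))) := by
    unfold chebApprox
    rw [← hcos, Finset.sum_range_succ', Finset.sum_range_succ']
    have : ∀ n : ℕ, chebCoef u (n + 1 + 1) *
        (Polynomial.Chebyshev.T ℝ ((n + 1 + 1 : ℕ) : ℤ)).eval (Real.cos θ) =
        u * ((-1) ^ n * Real.cos ((n + 2 : ℕ) * θ) /
        (((n + 2 : ℕ) : ℝ) ^ 3 - ((n + 2 : ℕ) : ℝ))) := by
      intro n
      rw [Polynomial.Chebyshev.T_real_cos]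
      simp only [chebCoef]
      rw [pow_add]
      push_cast
      ring_nf
    rw [Finset.sum_congr rfl (fun n _ => this n)]
    simp
    ring
  have hlog : Real.log (2 + 2 * Real.cos θ) = Real.log p - Real.log (u / 4) := by
    rw [← Real.log_div hp.ne' (by positivity), hcos]
    congr 1
    field_simp
    ring
  rw [hlog] at hsplit
  rw [hcheb]
  simp only [chebCoef]
  have hfin : u * ((1 + Real.cos θ) * (Real.log p - Real.log (u / 4)) / 2 - 1 / 2
      - 3 / 4 * Real.cos θ) = p * Real.log p - (u / 2 * (Real.log (u / 4) + 1)
      + u / 4 * (2 * Real.log (u / 4) + 3) * Real.cos θ) := by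
    rw [hcos]
    field_simp
    ring
  rw [hfin] at hsplit
  linarith

/-- If `m ≥ √(u/(2εℓ ln(1/(1−ℓ))))` then for every `p ∈ [ℓ, 1−ℓ]` with `p ≤ u`,
`−f_m(p) ≥ p ln(1/p) − εℓ ln(1/(1−ℓ)) ≥ (1−ε)ℓ ln(1/(1−ℓ)) ≥ 0`; consequently, for a
density matrix `R` whose eigenvalues lie in `[ℓ, min(u, 1−ℓ)]`, the matrix `−f_m(R)`
(defined via the spectral decomposition of `R`) is symmetric positive semidefinite. -/
theorem neg_chebApprox_nonneg_and_posSemidef (ℓ u : ℝ) (hℓ0 : 0 < ℓ) (hℓ1 : ℓ < 1)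
    (hu0 : 0 < u) (hu1 : u ≤ 1) (ε : ℝ) (hε : ε ∈ Set.Ioc (0 : ℝ) 1)
    (m : ℕ) (hm : Real.sqrt (u / (2 * ε * ℓ * Real.log (1 / (1 - ℓ)))) ≤ m) :
    (∀ p : ℝ, ℓ ≤ p → p ≤ 1 - ℓ → p ≤ u →
      (p * Real.log (1 / p) - ε * ℓ * Real.log (1 / (1 - ℓ)) ≤ -chebApprox u m p ∧
        (1 - ε) * ℓ * Real.log (1 / (1 - ℓ)) ≤
          p * Real.log (1 / p) - ε * ℓ * Real.log (1 / (1 - ℓ)) ∧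
        0 ≤ (1 - ε) * ℓ * Real.log (1 / (1 - ℓ)))) ∧
    (∀ (n : ℕ) (R : Matrix (Fin n) (Fin n) ℝ) (hR : R.PosSemidef)
        (_ : R.trace = 1),
      (∀ i, hR.1.eigenvalues i ∈ Set.Icc ℓ (min u (1 - ℓ))) →
      Matrix.PosSemidef
        ((hR.1.eigenvectorUnitary : Matrix (Fin n) (Fin n) ℝ) *
          Matrix.diagonal (fun i => -chebApprox u m (hR.1.eigenvalues i)) *
          star (hR.1.eigenvectorUnitary : Matrix (Fin n) (Fin n) ℝ))) := by
  obtain ⟨hε0, hε1⟩ := hε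
  have hL : 0 < Real.log (1 / (1 - ℓ)) := by
    apply Real.log_pos
    rw [lt_div_iff₀ (by linarith)]; linarith
  have hD : 0 < ε * ℓ * Real.log (1 / (1 - ℓ)) := by positivity
  have hm2 : u / (2 * ε * ℓ * Real.log (1 / (1 - ℓ))) ≤ (m : ℝ) ^ 2 :=
    Real.sqrt_le_iff.1 hm |>.2
  have hq : 0 < u / (2 * ε * ℓ * Real.log (1 / (1 - ℓ))) := by positivity
  have hm0 : m ≠ 0 := by
    rintro rfl
    rw [Nat.cast_zero, zero_pow two_ne_zero] at hm2
    linarith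
  have hA : ∀ p : ℝ, ℓ ≤ p → p ≤ 1 - ℓ → p ≤ u →
      (p * Real.log (1 / p) - ε * ℓ * Real.log (1 / (1 - ℓ)) ≤ -chebApprox u m p ∧
        (1 - ε) * ℓ * Real.log (1 / (1 - ℓ)) ≤
          p * Real.log (1 / p) - ε * ℓ * Real.log (1 / (1 - ℓ)) ∧
        0 ≤ (1 - ε) * ℓ * Real.log (1 / (1 - ℓ))) := by
    intro p h1 h2 h3
    have hp : 0 < p := by linarith
    refine ⟨?_, ?_, ?_⟩
    · obtain ⟨k, rfl⟩ := Nat.exists_eq_succ_of_ne_zero hm0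
      have := aux_main u hu0 k p hp h3
      have hb : u * (1 / (2 * ((k : ℝ) + 1) * (k + 2))) ≤ ε * ℓ * Real.log (1 / (1 - ℓ)) := by
        rw [div_le_iff₀ (by positivity)] at hm2
        rw [mul_one_div, div_le_iff₀ (by positivity)]
        push_cast at hm2
        have hk : (0 : ℝ) ≤ k + 1 := by positivity
        nlinarith [mul_nonneg hD.le hk]
      rw [one_div p, Real.log_inv]
      rw [Nat.succ_eq_add_one]
      linarith
    · have hle : Real.log (1 / (1 - ℓ)) ≤ Real.log (1 / p) :=
        Real.log_le_log (one_div_pos.2 (by linarith)) (one_div_le_one_div_of_le hp h2)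
      have := mul_le_mul h1 hle hL.le hp.le
      linarith
    · have : 0 ≤ 1 - ε := by linarith
      positivity
  refine ⟨hA, ?_⟩
  intro n R hR _ hev
  refine Matrix.PosSemidef.mul_mul_conjTranspose_same (Matrix.posSemidef_diagonal_iff.2 ?_) _
  intro i
  obtain ⟨h1, h2⟩ := hev i
  obtain ⟨a, b, c⟩ := hA _ h1 (h2.trans (min_le_right _ _)) (h2.trans (min_le_left _ _))
  linarith
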